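/- arXiv:1812.06612 — 2 statements merged into one kernel-verified Lean document; each statement's English description precedes it below -/
import Mathlib

section
/- Let 1 ≤ p, p_1, p_2 < ∞. If the Hölder-type inequality ‖XY‖_{ℓ_p(ℝ)} ≤ ‖X‖_{ℓ_{p_1}(ℝ)} · ‖Y‖_{ℓ_{p_2}(ℝ)} holds for every X ∈ ℓ_{p_1}(ℝ) and every Y ∈ ℓ_{p_2}(ℝ) (where XY denotes the pointwise product), then 1/p_1 + 1/p_2 ≥ 1/p. -/
/-- Necessity: if `1 ≤ p, p₁, p₂ < ∞` and the Hölder-type inequality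
`‖XY‖_{ℓ_p} ≤ ‖X‖_{ℓ_{p₁}} ‖Y‖_{ℓ_{p₂}}` holds for every `X ∈ ℓ_{p₁}(ℝ)` and
`Y ∈ ℓ_{p₂}(ℝ)`, then `1/p₁ + 1/p₂ ≥ 1/p`. -/
theorem holder_lp_necessary (p p₁ p₂ : ℝ) (hp : 1 ≤ p) (hp₁ : 1 ≤ p₁) (hp₂ : 1 ≤ p₂)
    (H : ∀ x y : ℕ → ℝ, Summable (fun n => |x n| ^ p₁) → Summable (fun n => |y n| ^ p₂) →
      (∑' n, |x n * y n| ^ p) ^ (1 / p) ≤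
        (∑' n, |x n| ^ p₁) ^ (1 / p₁) * (∑' n, |y n| ^ p₂) ^ (1 / p₂)) :
    1 / p ≤ 1 / p₁ + 1 / p₂ := by
  set x : ℕ → ℝ := fun n => if n < 2 then 1 else 0 with hx
  have hpow : ∀ q : ℝ, 1 ≤ q → ∀ n, |x n| ^ q = x n := by
    intro q hq n
    have hq0 : q ≠ 0 := by linarith
    simp only [hx]
    split_ifs <;> simp [hq0]
  have hsq : ∀ n, x n * x n = x n := by
    intro n
    simp [hx]
  have hsum : HasSum x 2 := by
    have h : HasSum x (∑ n ∈ Finset.range 2, x n) :=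
      hasSum_sum_of_ne_finset_zero fun n hn => by
        exact if_neg (by simpa only [Finset.mem_range] using hn)
    convert h using 1
    rw [Finset.sum_range_succ, Finset.sum_range_one]
    norm_num [hx]
  have h := H x x (by simpa only [hpow p₁ hp₁] using hsum.summable)
    (by simpa only [hpow p₂ hp₂] using hsum.summable)
  simp only [hsq, hpow p hp, hpow p₁ hp₁, hpow p₂ hp₂, hsum.tsum_eq] at h
  rw [← Real.rpow_add two_pos] at h
  exact (Real.rpow_le_rpow_left_iff one_lt_two).mp h
end

section
/- Let m ≥ 1 and 1 ≤ p_1, p_2, ..., p_m, p < ∞. If the generalized Hölder-type inequality ‖∏_{i=1}^m X_i‖_{ℓ_p(ℝ)} ≤ ∏_{i=1}^m ‖X_i‖_{ℓ_{p_i}(ℝ)} holds for every choice of sequences X_i ∈ ℓ_{p_i}(ℝ), i = 1, ..., m (where ∏_{i=1}^m X_i denotes the pointwise product), then ∑_{i=1}^m 1/p_i ≥ 1/p. -/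
theorem hasSum_abs_indicator_rpow {ι : Type*} (s : Finset ι) {q : ℝ} (hq : q ≠ 0) :
    HasSum (fun n => |(s : Set ι).indicator (1 : ι → ℝ) n| ^ q) s.card := by
  have h := hasSum_sum_of_ne_finset_zero (s := s) (L := .unconditional ι)
    (f := fun n => |(s : Set ι).indicator (1 : ι → ℝ) n| ^ q)
    (fun n hn => by simp [hn, Real.zero_rpow hq])
  rw [Finset.sum_congr rfl (g := fun _ => (1 : ℝ)) (fun n hn => by simp [hn])] at h
  simpa using h


/-- Necessity: if `m ≥ 1`, `1 ≤ p₁, ..., p_m, p < ∞`, and the generalized Hölder-type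
inequality `‖∏ Xᵢ‖_{ℓ_p} ≤ ∏ ‖Xᵢ‖_{ℓ_{pᵢ}}` holds for every choice of sequences
`Xᵢ ∈ ℓ_{pᵢ}(ℝ)`, then `∑ 1/pᵢ ≥ 1/p`. -/
theorem generalized_holder_lp_necessary (m : ℕ) (hm : 1 ≤ m)
    (p : ℝ) (P : Fin m → ℝ) (hp : 1 ≤ p) (hP : ∀ i, 1 ≤ P i)
    (H : ∀ x : Fin m → ℕ → ℝ, (∀ i, Summable (fun n => |x i n| ^ (P i))) →
      (∑' n, |∏ i, x i n| ^ p) ^ (1 / p) ≤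
        ∏ i, (∑' n, |x i n| ^ (P i)) ^ (1 / P i)) :
    1 / p ≤ ∑ i, 1 / P i := by
  let e : ℕ → ℝ := (Finset.range 2 : Set ℕ).indicator 1
  have he {q : ℝ} (hq : 1 ≤ q) : HasSum (fun n => |e n| ^ q) 2 := by
    simpa only [Finset.card_range, Nat.cast_ofNat] using
      hasSum_abs_indicator_rpow (Finset.range 2) (zero_lt_one.trans_le hq).ne'
  have hprod (n : ℕ) : ∏ _i : Fin m, e n = e n := by
    have hm0 : m ≠ 0 := by lia
    by_cases hn : n < 2 <;> simp [e, hn, hm0]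
  have h := H (fun _ => e) fun i => (he (hP i)).summable
  simp only [hprod, (he hp).tsum_eq, (he (hP _)).tsum_eq] at h
  rw [← Real.rpow_sum_of_pos two_pos] at h
  exact (Real.rpow_le_rpow_left_iff one_lt_two).mp h
end
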